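/- Let G and G'' be Gauss diagrams such that G'' is obtained from G by adding or removing two adjacent shell-pairs of opposite signs (eight consecutive chord endpoints forming a shell-pair of sign ε followed by a shell-pair of sign −ε). Then G and G'' are related by a finite sequence of Ξ-moves and Reidemeister moves. -/

import Mathlib

/-!
Combinatorial Gauss diagrams.

A Gauss diagram is encoded as a list of chord endpoints read along the
oriented circle from a basepoint.  Each endpoint records the (natural number)
label of its chord, whether it is the terminal endpoint of the (oriented)
chord, and the sign of the chord (`true` = +1, `false` = -1).
Diagrams are considered up to rotation of the basepoint and relabeling of the
chords; these renamings are included among the "Reidemeister" generators.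
-/

structure Endpoint where
  label : ℕ
  isTerminal : Bool
  sign : Bool
deriving DecidableEq

namespace Gauss

/-- The sign (±1) of the chord through an endpoint. -/
def signValue (e : Endpoint) : ℤ := if e.sign then 1 else -1

/-- The sign assigned to an endpoint: `ε` at the terminal endpoint and `-ε`
at the initial endpoint of a chord of sign `ε`. -/
def endpointValue (e : Endpoint) : ℤ := if e.isTerminal then signValue e else -signValue e

/-- The list of chord labels of the endpoints of a word. -/
def labels (L : List Endpoint) : List ℕ := L.map Endpoint.label

/-- A word is a Gauss diagram when every chord label occurring in it occurs
exactly twice, once as an initial and once as a terminal endpoint, with the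
same sign at both occurrences. -/
def IsGaussDiagram (L : List Endpoint) : Prop :=
  ∀ e ∈ L, (L.filter (fun x => x.label == e.label)).length = 2 ∧
    ∃ e' ∈ L, e'.label = e.label ∧ e'.isTerminal = !e.isTerminal ∧ e'.sign = e.sign

/-- Rotate a word so that the first endpoint satisfying `p` comes first. -/
def rotateTo (L : List Endpoint) (p : Endpoint → Bool) : List Endpoint :=
  match L.findIdx? p with
  | some i => L.drop i ++ L.take i
  | none => L

/-- The index of the chord labeled `c`: the sum of the signs assigned to the
endpoints on the arc running from the initial endpoint of the chord to its
terminal endpoint in the direction of the circle's orientation. -/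
def chordIndex (L : List Endpoint) (c : ℕ) : ℤ :=
  ((((rotateTo L (fun e => e.label == c && !e.isTerminal)).drop 1).takeWhile
      (fun e => e.label != c)).map endpointValue).sum

/-- `Jn L n`: the sum of the signs of the chords of `L` of index `n`. -/
def Jn (L : List Endpoint) (n : ℤ) : ℤ :=
  ((L.filter (fun e => e.isTerminal && decide (chordIndex L e.label = n))).map signValue).sum

/-- The odd writhe: the sum of the signs of the chords of odd index,
i.e. `J = Σ_{n odd} J_n`. -/
def oddWrithe (L : List Endpoint) : ℤ :=
  ((L.filter (fun e => e.isTerminal && decide (chordIndex L e.label % 2 ≠ 0))).map signValue).sum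

/-- Moving the basepoint of the circle. -/
def rotateStep (L L' : List Endpoint) : Prop :=
  ∃ x xs, L = x :: xs ∧ L' = xs ++ [x]

/-- Injective relabeling of the chords. -/
def relabelStep (L L' : List Endpoint) : Prop :=
  ∃ f : ℕ → ℕ, Function.Injective f ∧
    L' = L.map (fun e => Endpoint.mk (f e.label) e.isTerminal e.sign)

/-- Reidemeister move I (removal direction): remove an isolated chord whose
two endpoints are adjacent (either orientation, either sign). -/
def reid1 (L L' : List Endpoint) : Prop :=
  ∃ (A B : List Endpoint) (c : ℕ) (t s : Bool),
    c ∉ labels (A ++ B) ∧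
    L = A ++ [Endpoint.mk c t s, Endpoint.mk c (!t) s] ++ B ∧
    L' = A ++ B

/-- Reidemeister move II (removal direction): remove two chords of opposite
signs whose initial endpoints are adjacent and whose terminal endpoints are
adjacent (in either of the two admissible orders). -/
def reid2 (L L' : List Endpoint) : Prop :=
  ∃ (A B C : List Endpoint) (c d : ℕ) (s crossed : Bool),
    c ≠ d ∧ c ∉ labels (A ++ B ++ C) ∧ d ∉ labels (A ++ B ++ C) ∧
    L = A ++ [Endpoint.mk c false s, Endpoint.mk d false (!s)] ++ B ++
        (if crossed then [Endpoint.mk c true s, Endpoint.mk d true (!s)]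
         else [Endpoint.mk d true (!s), Endpoint.mk c true s]) ++ C ∧
    L' = A ++ B ++ C

/-- Reidemeister move III (a standard variant; together with the moves I, II,
rotations and relabelings it generates all versions of the third move). -/
def reid3 (L L' : List Endpoint) : Prop :=
  ∃ (A B C D : List Endpoint) (a b c : ℕ) (s : Bool),
    a ≠ b ∧ b ≠ c ∧ a ≠ c ∧
    L = A ++ [Endpoint.mk b false s, Endpoint.mk a false s] ++ B ++
        [Endpoint.mk a true s, Endpoint.mk c false (!s)] ++ C ++
        [Endpoint.mk b true s, Endpoint.mk c true (!s)] ++ D ∧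
    L' = A ++ [Endpoint.mk a false s, Endpoint.mk b false s] ++ B ++
        [Endpoint.mk c false (!s), Endpoint.mk a true s] ++ C ++
        [Endpoint.mk c true (!s), Endpoint.mk b true s] ++ D

/-- A single Reidemeister generator (including diagram renamings). -/
def reidStep (L L' : List Endpoint) : Prop :=
  rotateStep L L' ∨ relabelStep L L' ∨ reid1 L L' ∨ reid2 L L' ∨ reid3 L L'

/-- A Ξ-move: exchange the first and third of three consecutive endpoints
belonging to three distinct chords, keeping all signs and orientations. -/
def xiStep (L L' : List Endpoint) : Prop :=
  ∃ (A B : List Endpoint) (x y z : Endpoint),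
    x.label ≠ y.label ∧ y.label ≠ z.label ∧ x.label ≠ z.label ∧
    L = A ++ [x, y, z] ++ B ∧
    L' = A ++ [z, y, x] ++ B

/-- A 2k-move (removal direction): remove `2k` chords `c 0, …, c (2k-1)`, all
of sign `s`, whose `p`-endpoints appear consecutively on one arc and whose
`q`-endpoints appear consecutively on a disjoint arc, the chord `c i` being
oriented from `p` to `q` for even `i` (the paper's odd `i`, 1-indexed) and
from `q` to `p` for odd `i`, so initial and terminal endpoints alternate. -/
def move2k (k : ℕ) (L L' : List Endpoint) : Prop :=
  ∃ (A B C : List Endpoint) (c : ℕ → ℕ) (s : Bool),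
    (∀ i < 2 * k, ∀ j < 2 * k, c i = c j → i = j) ∧
    (∀ i < 2 * k, c i ∉ labels (A ++ B ++ C)) ∧
    L = A ++ (List.range (2 * k)).map (fun i => Endpoint.mk (c i) (decide (i % 2 = 1)) s)
          ++ B ++
        (List.range (2 * k)).map (fun i => Endpoint.mk (c i) (decide (i % 2 = 0)) s)
          ++ C ∧
    L' = A ++ B ++ C

/-- A crossing change: reverse the sign and the orientation of one chord. -/
def crossingChange (L L' : List Endpoint) : Prop :=
  ∃ c : ℕ,
    L' = L.map (fun e =>
      if e.label = c then Endpoint.mk e.label (!e.isTerminal) (!e.sign) else e)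

/-- Finite sequences of moves from `r`, performed in either direction. -/
def Moves (r : List Endpoint → List Endpoint → Prop) :
    List Endpoint → List Endpoint → Prop :=
  Relation.ReflTransGen (fun L L' => r L L' ∨ r L' L)

/-- Related by Reidemeister moves: the two words represent the same virtual knot. -/
def ReidEquiv : List Endpoint → List Endpoint → Prop := Moves reidStep

/-- Related by a finite sequence of 2k-moves (and Reidemeister moves). -/
def Rel2k (k : ℕ) : List Endpoint → List Endpoint → Prop :=
  Moves (fun L L' => reidStep L L' ∨ move2k k L L')

/-- Related by a finite sequence of Ξ-moves (and Reidemeister moves). -/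
def RelXi : List Endpoint → List Endpoint → Prop :=
  Moves (fun L L' => reidStep L L' ∨ xiStep L L')

/-- Related by a finite sequence of 2k-moves and Ξ-moves (and Reidemeister moves). -/
def Rel2kXi (k : ℕ) : List Endpoint → List Endpoint → Prop :=
  Moves (fun L L' => reidStep L L' ∨ move2k k L L' ∨ xiStep L L')

/-- Related by a finite sequence of crossing changes and Ξ-moves
(and Reidemeister moves). -/
def RelCCXi : List Endpoint → List Endpoint → Prop :=
  Moves (fun L L' => reidStep L L' ∨ crossingChange L L' ∨ xiStep L L')

/-- A shell-pair of sign `s`: two chords `c`, `d` of sign `s` whose four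
endpoints are consecutive, interleaved as 1st-3rd and 2nd-4th
(with arbitrary orientations `t`, `u` of the two shells). -/
def shellPair (c d : ℕ) (t u s : Bool) : List Endpoint :=
  [Endpoint.mk c t s, Endpoint.mk d u s, Endpoint.mk c (!t) s, Endpoint.mk d (!u) s]

/-- The Gauss diagram `G(a)`: `|a|` consecutive shell-pairs of sign `+1` if
`a > 0` and of sign `-1` if `a < 0`; `G(0)` has no chords.  It represents the
virtual knot `K(a)`. -/
def Gword (a : ℤ) : List Endpoint :=
  ((List.range a.natAbs).map
    (fun j => shellPair (2 * j) (2 * j + 1) false false (decide (0 < a)))).flatten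

/-- `Rel2kCount k m G G'`: `G` and `G'` are related by a finite sequence of
Reidemeister moves and exactly `m` 2k-moves. -/
inductive Rel2kCount (k : ℕ) : ℕ → List Endpoint → List Endpoint → Prop
  | refl (L : List Endpoint) : Rel2kCount k 0 L L
  | reid {m : ℕ} {L L' L'' : List Endpoint} :
      reidStep L L' ∨ reidStep L' L →
      Rel2kCount k m L' L'' → Rel2kCount k m L L''
  | move {m : ℕ} {L L' L'' : List Endpoint} :
      move2k k L L' ∨ move2k k L' L →
      Rel2kCount k m L' L'' → Rel2kCount k (m + 1) L L''

/-- The 2k-move distance: the minimal number of 2k-moves needed to relate the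
two diagrams (together with Reidemeister moves). -/
noncomputable def dist2k (k : ℕ) (L L' : List Endpoint) : ℕ :=
  sInf {m | Rel2kCount k m L L'}

end Gauss

namespace Gauss

theorem RelXi.symm {X Y : List Endpoint} (h : RelXi X Y) : RelXi Y X :=
  by
  induction h with
  | refl => exact Relation.ReflTransGen.refl
  | tail _ h2 ih => exact Relation.ReflTransGen.head h2.symm ih

theorem RelXi.trans {X Y Z : List Endpoint} (h : RelXi X Y) (h' : RelXi Y Z) : RelXi X Z :=
  Relation.ReflTransGen.trans h h'

theorem relXi_rotate (X Y : List Endpoint) : RelXi (X ++ Y) (Y ++ X) := by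
  induction X generalizing Y with
  | nil =>
    rw [List.append_nil]
    exact Relation.ReflTransGen.refl
  | cons x X ih =>
    have h1 : RelXi (x :: X ++ Y) (X ++ Y ++ [x]) :=
      Relation.ReflTransGen.single (Or.inl (Or.inl (Or.inl ⟨x, X ++ Y, rfl, rfl⟩)))
    have h2 := ih (Y ++ [x])
    simp only [List.append_assoc, List.cons_append, List.nil_append] at h1 h2 ⊢
    exact h1.trans h2

theorem relXi_xi (A B : List Endpoint) (x y z : Endpoint) (h1 : x.label ≠ y.label)
    (h2 : y.label ≠ z.label) (h3 : x.label ≠ z.label) :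
    RelXi (A ++ x :: y :: z :: B) (A ++ z :: y :: x :: B) :=
  Relation.ReflTransGen.single
    (Or.inl (Or.inr ⟨A, B, x, y, z, h1, h2, h3, by simp, by simp⟩))

theorem relXi_r1 (A B : List Endpoint) (c : ℕ) (t s : Bool) (h : c ∉ labels (A ++ B)) :
    RelXi (A ++ Endpoint.mk c t s :: Endpoint.mk c (!t) s :: B) (A ++ B) :=
  Relation.ReflTransGen.single
    (Or.inl (Or.inl (Or.inr (Or.inr (Or.inl ⟨A, B, c, t, s, h, by simp, rfl⟩)))))

/-- A pair of adjacent endpoints slides past any word avoiding its labels. -/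
theorem relXi_slide (W : List Endpoint) : ∀ (X : List Endpoint) (p q : Endpoint),
    p.label ≠ q.label → (∀ x ∈ W, x.label ≠ p.label) → (∀ x ∈ W, x.label ≠ q.label) →
    RelXi (X ++ p :: q :: W)
      (X ++ (W ++ (if W.length % 2 = 0 then [p, q] else [q, p]))) := by
  induction W with
  | nil => intro X p q _ _ _; exact Relation.ReflTransGen.refl
  | cons x W ih =>
    intro X p q hpq hp hq
    have h1 := relXi_xi X W p q x hpq (hq x (by simp)).symm (hp x (by simp)).symm
    have h2 := ih (X ++ [x]) q p hpq.symm (fun y hy => hq y (by simp [hy]))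
      (fun y hy => hp y (by simp [hy]))
    simp only [List.append_assoc, List.cons_append, List.nil_append] at h2
    refine h1.trans ?_
    convert h2 using 4
    simp only [List.length_cons]
    rcases Nat.mod_two_eq_zero_or_one W.length with h | h
    · rw [if_neg (by omega), if_pos h, List.cons_append]
    · rw [if_pos (by omega), if_neg (by omega), List.cons_append]

/-- The first chord of a shell-pair can be reversed, using the whole circle. -/
theorem relXi_flip (W : List Endpoint) (c d : ℕ) (t u s : Bool) (hcd : c ≠ d)
    (hc : c ∉ labels W) (hd : d ∉ labels W) (hW : W.length % 2 = 0) :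
    RelXi (shellPair c d t u s ++ W) (shellPair c d (!t) u s ++ W) := by
  obtain ⟨h, hh⟩ := Infinite.exists_notMem_finset
    (c :: d :: labels W).toFinset
  simp only [List.mem_toFinset, List.mem_cons, not_or] at hh
  obtain ⟨hhc, hhd, hhW⟩ := hh
  have s1 := (relXi_r1 [Endpoint.mk c t s, Endpoint.mk d u s]
    (Endpoint.mk c (!t) s :: Endpoint.mk d (!u) s :: W) h true true
    (by simpa [labels, hhc, hhd] using hhW)).symm
  have s2 := relXi_slide (Endpoint.mk d (!u) s :: W)
    [Endpoint.mk c t s, Endpoint.mk d u s, Endpoint.mk h true true]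
    (Endpoint.mk h (!true) true) (Endpoint.mk c (!t) s) hhc
    (by
      intro x hx
      rcases List.mem_cons.1 hx with rfl | hx
      · exact fun e => hhd e.symm
      · exact fun e => hhW (by simpa [labels] using ⟨x, hx, e⟩))
    (by
      intro x hx
      rcases List.mem_cons.1 hx with rfl | hx
      · exact fun e => hcd e.symm
      · exact fun e => hc (by simpa [labels] using ⟨x, hx, e⟩))
  rw [if_neg (by simp only [List.length_cons]; omega)] at s2
  have s3 := relXi_rotate ([Endpoint.mk c t s, Endpoint.mk d u s, Endpoint.mk h true true] ++
    Endpoint.mk d (!u) s :: W) [Endpoint.mk c (!t) s, Endpoint.mk h (!true) true]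
  have s4 := relXi_xi [Endpoint.mk c (!t) s] (Endpoint.mk h true true :: Endpoint.mk d (!u) s :: W)
    (Endpoint.mk h (!true) true) (Endpoint.mk c t s) (Endpoint.mk d u s) hhc hcd hhd
  have s5 := relXi_r1 [Endpoint.mk c (!t) s, Endpoint.mk d u s, Endpoint.mk c t s]
    (Endpoint.mk d (!u) s :: W) h false true
    (by simpa [labels, hhc, hhd] using hhW)
  simp only [shellPair, List.append_assoc, List.cons_append, List.nil_append, Bool.not_not,
    Bool.not_true, Bool.not_false] at *
  exact s1.trans (s2.trans (s3.trans (s4.trans s5)))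

/-- The second Reidemeister move (parallel order), either endpoint first. -/
theorem relXi_r2 (A B C : List Endpoint) (c d : ℕ) (t s : Bool) (hcd : c ≠ d)
    (hc : c ∉ labels (A ++ B ++ C)) (hd : d ∉ labels (A ++ B ++ C)) :
    RelXi (A ++ [Endpoint.mk c t s, Endpoint.mk d t (!s)] ++ B ++
      [Endpoint.mk c (!t) s, Endpoint.mk d (!t) (!s)] ++ C) (A ++ B ++ C) := by
  cases t with
  | false =>
    exact Relation.ReflTransGen.single (Or.inl (Or.inl (Or.inr (Or.inr (Or.inr (Or.inl
      ⟨A, B, C, c, d, s, true, hcd, hc, hd, by simp, rfl⟩))))))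
  | true =>
    have h1 := relXi_rotate (A ++ [Endpoint.mk c true s, Endpoint.mk d true (!s)] ++ B)
      ([Endpoint.mk c false s, Endpoint.mk d false (!s)] ++ C)
    have h2 : RelXi ([] ++ [Endpoint.mk c false s, Endpoint.mk d false (!s)] ++ (C ++ A) ++
        [Endpoint.mk c true s, Endpoint.mk d true (!s)] ++ B) ([] ++ (C ++ A) ++ B) :=
      Relation.ReflTransGen.single (Or.inl (Or.inl (Or.inr (Or.inr (Or.inr (Or.inl
      ⟨[], C ++ A, B, c, d, s, true, hcd, by simp [labels] at hc ⊢; tauto,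
        by simp [labels] at hd ⊢; tauto, by simp, rfl⟩))))))
    have h3 := relXi_rotate C (A ++ B)
    simp only [List.append_assoc, List.cons_append, List.nil_append, Bool.not_true] at *
    exact h1.trans (h2.trans h3)

/-- Cancellation when the orientations match. -/
theorem relXi_cancel (W : List Endpoint) (c d c' d' : ℕ) (t u s : Bool)
    (hcd : c ≠ d) (hcc' : c ≠ c') (hcd' : c ≠ d')
    (hdc' : d ≠ c') (hdd' : d ≠ d') (hc'd' : c' ≠ d')
    (hc : c ∉ labels W) (hd : d ∉ labels W)
    (hc' : c' ∉ labels W) (hd' : d' ∉ labels W) :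
    RelXi (shellPair c d t u s ++ (shellPair c' d' u t (!s) ++ W)) W := by
  have s1 := relXi_xi [Endpoint.mk c t s, Endpoint.mk d u s]
    (Endpoint.mk d' t (!s) :: Endpoint.mk c' (!u) (!s) :: Endpoint.mk d' (!t) (!s) :: W)
    (Endpoint.mk c (!t) s) (Endpoint.mk d (!u) s) (Endpoint.mk c' u (!s)) hcd hdc' hcc'
  have s2 := relXi_xi [Endpoint.mk c t s, Endpoint.mk d u s, Endpoint.mk c' u (!s),
      Endpoint.mk d (!u) s]
    (Endpoint.mk d' (!t) (!s) :: W)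
    (Endpoint.mk c (!t) s) (Endpoint.mk d' t (!s)) (Endpoint.mk c' (!u) (!s))
    hcd' hc'd'.symm hcc'
  have s3 := relXi_r2 [Endpoint.mk c t s] []
    (Endpoint.mk d' t (!s) :: Endpoint.mk c (!t) s :: Endpoint.mk d' (!t) (!s) :: W)
    d c' u s hdc' (by simpa [labels, hcd.symm, hdd'] using hd)
    (by simpa [labels, hcc'.symm, hc'd'] using hc')
  have s4 := relXi_r2 [] [] W c d' t s hcd' (by simpa using hc) (by simpa using hd')
  simp only [shellPair, List.append_assoc, List.cons_append, List.nil_append] at *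
  exact s1.trans (s2.trans (s3.trans s4))

theorem relXi_flip_if (W : List Endpoint) (c d : ℕ) (t v u s : Bool) (hcd : c ≠ d)
    (hc : c ∉ labels W) (hd : d ∉ labels W) (hW : W.length % 2 = 0) :
    RelXi (shellPair c d t u s ++ W) (shellPair c d v u s ++ W) := by
  by_cases h : v = t
  · subst h; exact Relation.ReflTransGen.refl
  · have : v = !t := by cases v <;> cases t <;> simp_all
    subst this
    exact relXi_flip W c d t u s hcd hc hd hW

theorem IsGaussDiagram.even_length {L : List Endpoint} (h : IsGaussDiagram L) :
    L.length % 2 = 0 := by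
  have h1 := List.sum_toFinset_count_eq_length (labels L)
  have h2 : ∀ a ∈ (labels L).toFinset, (labels L).count a = 2 := by
    intro a ha
    simp only [labels, List.mem_toFinset, List.mem_map] at ha
    obtain ⟨e, he, rfl⟩ := ha
    rw [← (h e he).1, labels, List.count, List.countP_map, List.countP_eq_length_filter]
    rfl
  rw [Finset.sum_congr rfl h2] at h1
  simp [labels] at h1
  omega

end Gauss

open Gauss in
/-- adding or removing two adjacent shell-pairs of opposite signs
is realized by Ξ-moves and Reidemeister moves. -/
theorem relXi_of_opposite_shellPairs
    (G G'' A B : List Endpoint) (c d c' d' : ℕ) (t u t' u' s : Bool)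
    (hcd : c ≠ d) (hcc' : c ≠ c') (hcd' : c ≠ d')
    (hdc' : d ≠ c') (hdd' : d ≠ d') (hc'd' : c' ≠ d')
    (hc : c ∉ labels (A ++ B)) (hd : d ∉ labels (A ++ B))
    (hc' : c' ∉ labels (A ++ B)) (hd' : d' ∉ labels (A ++ B))
    (hG : G = A ++ shellPair c d t u s ++ shellPair c' d' t' u' (!s) ++ B)
    (hG'' : G'' = A ++ B)
    (hvalid : IsGaussDiagram G) :
    RelXi G G'' := by
  subst hG hG''
  have hlen := hvalid.even_length
  have hBA : ∀ x, x ∉ labels (A ++ B) → x ∉ labels (B ++ A) := by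
    intro x hx
    simp only [labels, List.map_append, List.mem_append] at hx ⊢
    tauto
  have hW : (B ++ A).length % 2 = 0 := by
    simp [shellPair] at hlen ⊢
    omega
  have gc := hBA c hc
  have gd := hBA d hd
  have gc' := hBA c' hc'
  have gd' := hBA d' hd'
  have s1 := relXi_rotate A (shellPair c d t u s ++ shellPair c' d' t' u' (!s) ++ B)
  have s2 := relXi_flip_if (shellPair c' d' t' u' (!s) ++ (B ++ A)) c d t u' u s hcd
    (by simpa [labels, shellPair, hcc', hcd'] using gc)
    (by simpa [labels, shellPair, hdc', hdd'] using gd)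
    (by simp [shellPair] at hW ⊢; omega)
  have s3 := relXi_rotate (shellPair c d u' u s) (shellPair c' d' t' u' (!s) ++ (B ++ A))
  have s4 := relXi_flip_if (B ++ A ++ shellPair c d u' u s) c' d' t' u u' (!s) hc'd'
    (by simpa [labels, shellPair, hcc'.symm, hdc'.symm] using gc')
    (by simpa [labels, shellPair, hcd'.symm, hdd'.symm] using gd')
    (by simp [shellPair] at hW ⊢; omega)
  have s5 := relXi_rotate (shellPair c' d' u u' (!s) ++ (B ++ A)) (shellPair c d u' u s)
  have s6 := relXi_cancel (B ++ A) c d c' d' u' u s hcd hcc' hcd' hdc' hdd' hc'd' gc gd gc' gd'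
  have s7 := relXi_rotate B A
  simp only [List.append_assoc] at *
  exact s1.trans (s2.trans (s3.trans (s4.trans (s5.trans (s6.trans s7)))))
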